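/- arXiv:1708.02639 — 4 statements merged into one kernel-verified Lean document; each statement's English description precedes it below -/
import Mathlib

section
/- Let A, X be finite sets and let M : A × X → {-1,1} be a (k',ℓ')-L₂-extractor with error 2^{-r'}. Let f : X → ℝ be non-negative, not identically zero, with ‖f‖₂ ≤ 2^{ℓ'}·‖f‖₁, and for a ∈ A set t(a) = |⟨M_a,f⟩|/‖f‖₁. Then for every natural number k, E_{a∈A}[(1 + t(a))^k] ≤ (1 + 2^{-r'})^k + 2^{k−k'}, where the expectation is over a uniform in A. -/
open Finset

attribute [local instance] Classical.propDecidable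

/-- Expectation with respect to the uniform distribution on a finite set. -/
noncomputable def expE {X : Type*} [Fintype X] (f : X → ℝ) : ℝ :=
  (∑ x, f x) / (Fintype.card X)

/-- Inner product with respect to the uniform distribution. -/
noncomputable def nInner {X : Type*} [Fintype X] (f g : X → ℝ) : ℝ :=
  expE (fun x => f x * g x)

/-- Normalized ℓ₁-norm. -/
noncomputable def nNorm1 {X : Type*} [Fintype X] (f : X → ℝ) : ℝ :=
  expE (fun x => |f x|)

/-- Normalized ℓ₂-norm. -/
noncomputable def nNorm2 {X : Type*} [Fintype X] (f : X → ℝ) : ℝ :=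
  Real.sqrt (expE (fun x => (f x) ^ 2))

/-- `M` is a `(k,ℓ)`-L₂-extractor with error `2^{-r}`. -/
def IsL2Extractor {A X : Type*} [Fintype A] [Fintype X]
    (M : A → X → ℝ) (k ℓ r : ℝ) : Prop :=
  ∀ f : X → ℝ, (∀ x, 0 ≤ f x) → f ≠ 0 →
    nNorm2 f ≤ (2 : ℝ) ^ ℓ * nNorm1 f →
    ((Finset.univ.filter
        (fun a : A => (2 : ℝ) ^ (-r) * nNorm1 f ≤ |nInner (M a) f|)).card : ℝ)
      ≤ (2 : ℝ) ^ (-k) * (Fintype.card A)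

theorem nNorm1_pos {X : Type*} [Fintype X] {f : X → ℝ} (hf : f ≠ 0) : 0 < nNorm1 f := by
  obtain ⟨x, hx⟩ := Function.ne_iff.mp hf
  have : Nonempty X := ⟨x⟩
  exact div_pos (Finset.sum_pos' (fun _ _ => abs_nonneg _) ⟨x, mem_univ x, abs_pos.mpr hx⟩)
    (by exact_mod_cast Fintype.card_pos)

theorem abs_nInner_le_nNorm1 {X : Type*} [Fintype X] {g : X → ℝ} (hg : ∀ x, |g x| ≤ 1)
    (f : X → ℝ) : |nInner g f| ≤ nNorm1 f := by
  unfold nInner nNorm1 expE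
  rw [abs_div, Nat.abs_cast]
  gcongr
  refine (abs_sum_le_sum_abs _ _).trans (sum_le_sum fun x _ => ?_)
  rw [abs_mul]
  exact mul_le_of_le_one_left (abs_nonneg _) (hg x)

/-- A moment of a `[0, 1]`-valued function, bounded by splitting at a threshold `ε`. -/
theorem expE_one_add_pow_le {A : Type*} [Fintype A] {t : A → ℝ} {ε δ : ℝ}
    (ht0 : ∀ a, 0 ≤ t a) (ht1 : ∀ a, t a ≤ 1) (hε : 0 ≤ ε) (hδ : 0 ≤ δ)
    (hcard : (#{a | ε ≤ t a} : ℝ) ≤ δ * Fintype.card A) (k : ℕ) :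
    expE (fun a => (1 + t a) ^ k) ≤ (1 + ε) ^ k + 2 ^ k * δ := by
  refine div_le_of_le_mul₀ (Nat.cast_nonneg _) (by positivity) ?_
  calc ∑ a, (1 + t a) ^ k
      ≤ ∑ a, ((1 + ε) ^ k + if ε ≤ t a then 2 ^ k else 0) := by
        refine sum_le_sum fun a _ => ?_
        have := ht0 a
        split_ifs with h
        · have : (1 + t a) ^ k ≤ 2 ^ k := by
            gcongr
            linarith [ht1 a]
          have : 0 ≤ (1 + ε) ^ k := by positivity
          linarith
        · rw [add_zero]
          gcongr
          exact (not_le.mp h).le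
    _ = (1 + ε) ^ k * Fintype.card A + 2 ^ k * #{a | ε ≤ t a} := by
        rw [sum_add_distrib, ← sum_filter, sum_const, sum_const, card_univ, nsmul_eq_mul,
          nsmul_eq_mul]
        ring
    _ ≤ (1 + ε) ^ k * Fintype.card A + 2 ^ k * (δ * Fintype.card A) := by gcongr
    _ = ((1 + ε) ^ k + 2 ^ k * δ) * Fintype.card A := by ring

/-- **Claim (bound on the moment `E_a[(1+t(a))^k]`).**
If `M` is a `(k',ℓ')`-L₂-extractor with error `2^{-r'}` and `f : X → ℝ` is
non-negative, nonzero, with `‖f‖₂ ≤ 2^{ℓ'}·‖f‖₁`, then with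
`t(a) = |⟨M_a,f⟩|/‖f‖₁`, one has, for every natural number `k`,
`E_{a∈A}[(1+t(a))^k] ≤ (1+2^{-r'})^k + 2^{k-k'}`. -/
theorem moment_bound {A X : Type*} [Fintype A] [Fintype X]
    (M : A → X → ℝ) (hM : ∀ a x, M a x = 1 ∨ M a x = -1)
    (k' ℓ' r' : ℝ) (hext : IsL2Extractor M k' ℓ' r')
    (f : X → ℝ) (hf0 : ∀ x, 0 ≤ f x) (hf : f ≠ 0)
    (hf2 : nNorm2 f ≤ (2 : ℝ) ^ ℓ' * nNorm1 f) :
    ∀ k : ℕ,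
      expE (fun a : A => (1 + |nInner (M a) f| / nNorm1 f) ^ k)
        ≤ (1 + (2 : ℝ) ^ (-r')) ^ k + (2 : ℝ) ^ ((k : ℝ) - k') := by
  intro k
  have hpos := nNorm1_pos hf
  have hM1 (a : A) (x : X) : |M a x| ≤ 1 := by rcases hM a x with h | h <;> simp [h]
  rw [sub_eq_add_neg, Real.rpow_add two_pos, Real.rpow_natCast]
  refine expE_one_add_pow_le (fun a => by positivity)
    (fun a => div_le_one_of_le₀ (abs_nInner_le_nNorm1 (hM1 a) f) hpos.le)
    (by positivity) (by positivity) ?_ k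
  simpa only [le_div_iff₀ hpos] using hext f hf0 hf hf2
end

section
/- Let A, X be finite sets and let M : A × X → {-1,1} be a (k',ℓ')-L₂-extractor with error 2^{-r}. Let P be a probability distribution on X satisfying ‖P‖₂ ≤ 2^{ℓ'−r}·‖P‖₁ (normalized norms over X). Then for every function h : A → {-1,1}, ∑_{x∈X} P(x)·⟨h, M^{(x)}⟩² ≤ 2·2^{-k'} + 2·2^{-r}, where M^{(x)} : A → {-1,1} is the x-th column of M (M^{(x)}(a) = M(a,x)) and ⟨h, M^{(x)}⟩ = E_{a∈A}[h(a)·M(a,x)]. Consequently, ∑_{x∈X} P(x)·|⟨h, M^{(x)}⟩| ≤ (2·2^{-k'} + 2·2^{-r})^{1/2}. -/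
open Finset

attribute [local instance] Classical.propDecidable

/-- A nonnegative function `Q` dominated by a flat distribution `P` has small average
correlation with the rows of an extractor. -/
lemma IsL2Extractor.sum_abs_le_of_le {A X : Type*} [Fintype A] [Fintype X]
    {M : A → X → ℝ} (hM : ∀ a x, M a x = 1 ∨ M a x = -1)
    {k l r : ℝ} (hext : IsL2Extractor M k l r)
    {P : X → ℝ} (hP1 : (∑ x, P x) = 1)
    (hP2 : nNorm2 P ≤ (2 : ℝ) ^ (l - r) * nNorm1 P)
    {Q : X → ℝ} (hQ0 : ∀ x, 0 ≤ Q x) (hQP : ∀ x, Q x ≤ P x) :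
    ∑ a, |∑ x, M a x * Q x| ≤ ((2 : ℝ) ^ (-k) + (2 : ℝ) ^ (-r)) * Fintype.card A := by
  have hP0 : ∀ x, 0 ≤ P x := fun x => (hQ0 x).trans (hQP x)
  have hX : (0 : ℝ) < Fintype.card X := by
    have : Nonempty X := by
      by_contra hne
      rw [not_nonempty_iff] at hne
      simp at hP1
    exact_mod_cast Fintype.card_pos
  have hk : (0 : ℝ) < 2 ^ (-k) := by positivity
  have hr : (0 : ℝ) < 2 ^ (-r) := by positivity
  have hl : (0 : ℝ) < 2 ^ l := by positivity
  have hQ1 : ∑ x, Q x ≤ 1 := hP1 ▸ sum_le_sum fun x _ => hQP x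
  have habs : ∀ a, |∑ x, M a x * Q x| ≤ ∑ x, Q x := fun a => by
    refine (abs_sum_le_sum_abs _ _).trans (sum_le_sum fun x _ => ?_)
    rcases hM a x with h | h <;> simp [h, abs_of_nonneg (hQ0 x)]
  have hnQ : nNorm1 Q = (∑ x, Q x) / Fintype.card X := by
    simp [nNorm1, expE, abs_of_nonneg (hQ0 _)]
  have hnP : nNorm1 P = 1 / Fintype.card X := by
    simp [nNorm1, expE, abs_of_nonneg (hP0 _), hP1]
  rcases le_or_gt ((2 : ℝ) ^ (-r)) (∑ x, Q x) with hbig | hsmall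
  · have hQne : Q ≠ 0 := by
      rintro rfl
      simp at hbig
      linarith
    have hflat : nNorm2 Q ≤ (2 : ℝ) ^ l * nNorm1 Q := by
      have h1 : nNorm2 Q ≤ nNorm2 P := by
        unfold nNorm2 expE
        refine Real.sqrt_le_sqrt (div_le_div_of_nonneg_right (sum_le_sum fun x _ => ?_) hX.le)
        exact pow_le_pow_left₀ (hQ0 x) (hQP x) 2
      refine (h1.trans hP2).trans ?_
      rw [hnP, hnQ, sub_eq_add_neg, Real.rpow_add two_pos, mul_assoc, mul_one_div]
      gcongr
    have hcard := hext Q hQ0 hQne hflat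
    set B := univ.filter (fun a : A => (2 : ℝ) ^ (-r) * nNorm1 Q ≤ |nInner (M a) Q|)
    have hpt : ∀ a, |∑ x, M a x * Q x| ≤ (if a ∈ B then 1 else 0) + (2 : ℝ) ^ (-r) := fun a => by
      split_ifs with ha
      · linarith [habs a]
      · have ha' : |nInner (M a) Q| < (2 : ℝ) ^ (-r) * nNorm1 Q := by
          simpa [B] using ha
        rw [hnQ, nInner, expE, abs_div, abs_of_pos hX, ← mul_div_assoc,
          div_lt_div_iff_of_pos_right hX] at ha'
        nlinarith
    calc ∑ a, |∑ x, M a x * Q x|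
        ≤ ∑ a, ((if a ∈ B then 1 else 0) + (2 : ℝ) ^ (-r)) := sum_le_sum fun a _ => hpt a
      _ = (B.card : ℝ) + (2 : ℝ) ^ (-r) * Fintype.card A := by
          simp [sum_add_distrib, mul_comm]
      _ ≤ _ := by linarith
  · calc ∑ a, |∑ x, M a x * Q x| ≤ ∑ _a : A, ((2 : ℝ) ^ (-k) + (2 : ℝ) ^ (-r)) :=
          sum_le_sum fun a _ => by linarith [habs a]
      _ = _ := by rw [sum_const, nsmul_eq_mul, card_univ, mul_comm]

/-- **Claim (low correlation of any hypothesis under a flat distribution).**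
If `M` is a `(k',ℓ')`-L₂-extractor with error `2^{-r}` and `P` is a
probability distribution on `X` with `‖P‖₂ ≤ 2^{ℓ'-r}·‖P‖₁`, then for every
`±1`-valued hypothesis `h : A → ℝ`,
`∑_x P(x)·⟨h,M^{(x)}⟩² ≤ 2·2^{-k'} + 2·2^{-r}`, and consequently
`∑_x P(x)·|⟨h,M^{(x)}⟩| ≤ (2·2^{-k'} + 2·2^{-r})^{1/2}`. -/
theorem hypothesis_low_correlation {A X : Type*} [Fintype A] [Fintype X]
    (M : A → X → ℝ) (hM : ∀ a x, M a x = 1 ∨ M a x = -1)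
    (k' ℓ' r : ℝ) (hext : IsL2Extractor M k' ℓ' r)
    (P : X → ℝ) (hP0 : ∀ x, 0 ≤ P x) (hP1 : (∑ x, P x) = 1)
    (hP2 : nNorm2 P ≤ (2 : ℝ) ^ (ℓ' - r) * nNorm1 P)
    (h : A → ℝ) (hh : ∀ a, h a = 1 ∨ h a = -1) :
    (∑ x, P x * (nInner h (fun a => M a x)) ^ 2
        ≤ 2 * (2 : ℝ) ^ (-k') + 2 * (2 : ℝ) ^ (-r)) ∧
    (∑ x, P x * |nInner h (fun a => M a x)|
        ≤ Real.sqrt (2 * (2 : ℝ) ^ (-k') + 2 * (2 : ℝ) ^ (-r))) := by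
  have hsq : ∑ x, P x * (nInner h (fun a => M a x)) ^ 2
      ≤ 2 * (2 : ℝ) ^ (-k') + 2 * (2 : ℝ) ^ (-r) := by
    set c : ℝ := 2 * (2 : ℝ) ^ (-k') + 2 * (2 : ℝ) ^ (-r)
    have hc : 0 ≤ c := by positivity
    have hrow : ∀ b, ∑ a, |∑ x, M a x * (P x * M b x)| ≤ c * Fintype.card A := fun b => by
      have hpos := hext.sum_abs_le_of_le hM hP1 hP2 (Q := fun x => if M b x = 1 then P x else 0)
        (fun x => by split_ifs <;> simp [hP0 x])
        (fun x => by split_ifs <;> simp [hP0 x])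
      have hneg := hext.sum_abs_le_of_le hM hP1 hP2 (Q := fun x => if M b x = 1 then 0 else P x)
        (fun x => by split_ifs <;> simp [hP0 x])
        (fun x => by split_ifs <;> simp [hP0 x])
      calc ∑ a, |∑ x, M a x * (P x * M b x)|
          ≤ ∑ a, (|∑ x, M a x * (if M b x = 1 then P x else 0)|
              + |∑ x, M a x * (if M b x = 1 then 0 else P x)|) := by
            refine sum_le_sum fun a _ => ?_
            refine le_trans (le_of_eq ?_) (abs_sub _ _)
            rw [← sum_sub_distrib]
            congr 1
            refine sum_congr rfl fun x _ => ?_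
            rcases hM b x with hb | hb <;> norm_num [hb]
        _ ≤ _ := by
            rw [sum_add_distrib]
            linarith
    have hexpand : ∑ x, P x * (∑ a, h a * M a x) ^ 2
        = ∑ b, ∑ a, h b * h a * ∑ x, M a x * (P x * M b x) := by
      simp_rw [sq, sum_mul_sum, mul_sum]
      rw [sum_comm]
      refine sum_congr rfl fun b _ => ?_
      rw [sum_comm]
      refine sum_congr rfl fun a _ => sum_congr rfl fun x _ => ?_
      ring
    have hbound : ∑ x, P x * (∑ a, h a * M a x) ^ 2 ≤ c * (Fintype.card A : ℝ) ^ 2 := by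
      rw [hexpand]
      calc _ ≤ ∑ _b : A, c * (Fintype.card A : ℝ) := by
            refine sum_le_sum fun b _ => le_trans (sum_le_sum fun a _ => ?_) (hrow b)
            refine (le_abs_self _).trans (le_of_eq ?_)
            rcases hh a with ha | ha <;> rcases hh b with hb | hb <;> simp [ha, hb]
        _ = _ := by
            simp
            ring
    simp_rw [nInner, expE, div_pow, ← mul_div_assoc]
    rw [← sum_div]
    exact div_le_of_le_mul₀ (by positivity) hc hbound
  refine ⟨hsq, Real.le_sqrt_of_sq_le (le_trans ?_ hsq)⟩
  have hcs := sum_sq_le_sum_mul_sum_of_sq_le_mul univ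
    (r := fun x => P x * |nInner h (fun a => M a x)|) (f := P)
    (g := fun x => P x * (nInner h (fun a => M a x)) ^ 2)
    (fun x _ => hP0 x) (fun x _ => mul_nonneg (hP0 x) (sq_nonneg _))
    (fun x _ => by rw [mul_pow, sq_abs, sq (P x), mul_assoc])
  rwa [hP1, one_mul] at hcs
end

section
/- (One-step progress claim.) There exists an absolute constant C > 0 such that the following holds. Let A, X be finite sets, n = log₂|X|, and let M : A × X → {-1,1} be a (k',ℓ')-L₂-extractor with error 2^{-r'}. Let k ≥ 1 be a natural number and ℓ, r ≥ C reals with 2r ≤ r', k + 2r ≤ k', and 3ℓ + 2r + 2 ≤ ℓ'. Let P and Q be probability distributions on X with (E_{x∈X}[P(x)²])^{1/2} ≤ 2^ℓ·2^{-n} and (E_{x∈X}[Q(x)²])^{1/2} ≤ 4·2^ℓ·2^{-n}. Define Sig = {x ∈ X : P(x) > 2^{2ℓ+2r}·2^{-n}}, Bad = {a ∈ A : |∑_{x∈X} M(a,x)·P(x)| ≥ 2^{-r'}}, and for a ∈ A \ Bad and b ∈ {-1,1} let c_{a,b} = ∑ P(x) summed over x ∉ Sig with M(a,x) = b; when c_{a,b}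 > 0 let P_{a,b} be the probability distribution on X with P_{a,b}(x) = P(x)/c_{a,b} if x ∉ Sig and M(a,x) = b, and P_{a,b}(x) = 0 otherwise. Then (1/|A|)·∑_{a∈A\Bad} ∑_{b∈{-1,1}, c_{a,b}>0} c_{a,b}·⟨P_{a,b}, Q⟩^k ≤ ⟨P, Q⟩^k·(1 + 2^{-r})^k + (2^{-2n+2})^k, where ⟨f,g⟩ = E_{x∈X}[f(x)·g(x)]. -/
open Finset

attribute [local instance] Classical.propDecidable

/-- For a `±1`-valued `m`, the mass of `h` on one side of `m` is half of its total mass plus half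
of its signed bias. -/
theorem sum_filter_sign_eq {X : Type*} [Fintype X] {m : X → ℝ} (hm : ∀ x, m x = 1 ∨ m x = -1)
    (S : Finset X) (h : X → ℝ) {b : ℝ} (hb : b = 1 ∨ b = -1) :
    ∑ x ∈ univ.filter (fun x => x ∉ S ∧ m x = b), h x
      = (∑ x, (if x ∉ S then h x else 0)
          + b * ∑ x, m x * (if x ∉ S then h x else 0)) / 2 := by
  rw [sum_filter, mul_sum, ← sum_add_distrib, sum_div]
  refine sum_congr rfl fun x _ => ?_
  by_cases hx : x ∈ S
  · simp [hx]
  · rcases hm x with h1 | h1 <;> rcases hb with rfl | rfl <;> simp [hx, h1] <;> norm_num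

/-- Markov's inequality: a distribution with small `ℓ₂`-norm has little mass on its heavy points. -/
theorem sum_heavy_le {X : Type*} [Fintype X] {P : X → ℝ} {L t u : ℝ} (ht : 0 < t) (hu : 0 < u)
    (hL : 0 ≤ L) (hcard : (Fintype.card X : ℝ) * u = 1) (hP : nNorm2 P ≤ L * u) :
    ∑ x ∈ univ.filter (fun x => t * u < P x), P x ≤ L ^ 2 / t := by
  have hsq : expE (fun x => P x ^ 2) ≤ (L * u) ^ 2 := (Real.sqrt_le_left (by positivity)).1 hP
  have hN : 0 < (Fintype.card X : ℝ) := by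
    by_contra! h
    nlinarith
  rw [expE, div_le_iff₀ hN] at hsq
  have hheavy : t * u * ∑ x ∈ univ.filter (fun x => t * u < P x), P x ≤ ∑ x, P x ^ 2 := by
    rw [mul_sum]
    refine (sum_le_sum fun x hx => ?_).trans
      (sum_le_sum_of_subset_of_nonneg (filter_subset _ _) fun x _ _ => sq_nonneg (P x))
    have hx' := (mem_filter.1 hx).2
    have : 0 < t * u := by positivity
    nlinarith
  rw [le_div_iff₀ ht]
  have h2 : (L * u) ^ 2 * (Fintype.card X : ℝ) = L ^ 2 * u := by
    linear_combination L ^ 2 * u * hcard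
  refine le_of_mul_le_mul_right ?_ hu
  linarith

theorem nNorm2_le_mul {X : Type*} [Fintype X] {f g : X → ℝ} {B : ℝ} (hB : 0 ≤ B)
    (hf : ∀ x, 0 ≤ f x) (hfg : ∀ x, f x ≤ B * g x) : nNorm2 f ≤ B * nNorm2 g := by
  have hsqrt : B * nNorm2 g = √(B ^ 2 * expE fun x => g x ^ 2) := by
    rw [nNorm2, Real.sqrt_mul (sq_nonneg B), Real.sqrt_sq hB]
  rw [hsqrt]
  refine Real.sqrt_le_sqrt ?_
  rw [expE, expE, ← mul_div_assoc, mul_sum]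
  gcongr with x
  have := pow_le_pow_left₀ (hf x) (hfg x) 2
  linarith [mul_pow B (g x) 2]

/-- A partial average of a function which is at most `hi` on a set of density `η` and at
most `lo` elsewhere. -/
theorem avg_le_of_card_le {A : Type*} [Fintype A] {S E : Finset A} {G : A → ℝ} {lo hi η : ℝ}
    (hlo : 0 ≤ lo) (hhi : 0 ≤ hi) (hη : 0 ≤ η)
    (hE : (E.card : ℝ) ≤ η * Fintype.card A)
    (hG : ∀ a ∈ S, a ∉ E → G a ≤ lo) (hG' : ∀ a ∈ S, G a ≤ hi) :
    1 / (Fintype.card A : ℝ) * ∑ a ∈ S, G a ≤ lo + η * hi := by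
  have hsum : ∑ a ∈ S, G a ≤ Fintype.card A * lo + E.card * hi := by
    calc ∑ a ∈ S, G a ≤ ∑ a ∈ S, (lo + if a ∈ E then hi else 0) := by
          refine sum_le_sum fun a ha => ?_
          by_cases h : a ∈ E
          · simpa [h] using (hG' a ha).trans (by linarith)
          · simpa [h] using hG a ha h
      _ ≤ ∑ a, (lo + if a ∈ E then hi else 0) :=
          sum_le_sum_of_subset_of_nonneg (subset_univ _) fun a _ _ => by split_ifs <;> linarith
      _ = Fintype.card A * lo + E.card * hi := by
          simp [sum_add_distrib]
  rcases (Nat.cast_nonneg (Fintype.card A) : (0 : ℝ) ≤ _).eq_or_lt with h0 | h0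
  · rw [← h0]
    simp only [div_zero, zero_mul]
    positivity
  · rw [one_div, inv_mul_le_iff₀ h0]
    nlinarith [mul_le_mul_of_nonneg_right hE hhi]

theorem pow_add_le_add_pow {ε : ℝ} (hε : 0 ≤ ε) {k : ℕ} (hk : 1 ≤ k) :
    (1 + ε) ^ k + ε ≤ (1 + 2 * ε) ^ k := by
  obtain ⟨j, rfl⟩ : ∃ j, k = j + 1 := ⟨k - 1, by omega⟩
  have h1 : (1 : ℝ) ≤ (1 + ε) ^ j := one_le_pow₀ (by linarith)
  have h2 : (1 + ε) ^ j ≤ (1 + 2 * ε) ^ j := by gcongr; linarith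
  rw [pow_succ, pow_succ]
  nlinarith

/-- Both conditional distributions of `P` given the sign of `m` have inner product at most `T / D`
with `Q` if they have mass at least `D` and unnormalized inner product at most `T`. -/
theorem sum_sign_mul_pow_le {X : Type*} [Fintype X] {m P Q : X → ℝ} {S : Finset X} {D T : ℝ}
    {k : ℕ} (hm : ∀ x, m x = 1 ∨ m x = -1) (hP0 : ∀ x, 0 ≤ P x) (hP1 : ∑ x, P x = 1)
    (hQ0 : ∀ x, 0 ≤ Q x) {c : ℝ → ℝ} {R : ℝ → X → ℝ}
    (hc : ∀ b, c b = ∑ x ∈ univ.filter (fun x => x ∉ S ∧ m x = b), P x)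
    (hR : ∀ b x, R b x = if x ∉ S ∧ m x = b then P x / c b else 0) (hD : 0 < D)
    (hcD : ∀ b, b = 1 ∨ b = -1 → D ≤ c b)
    (hT : ∀ b, b = 1 ∨ b = -1 →
      (∑ x ∈ univ.filter (fun x => x ∉ S ∧ m x = b), P x * Q x) / Fintype.card X ≤ T) :
    ∑ b ∈ ({-1, 1} : Finset ℝ), (if 0 < c b then c b * nInner (R b) Q ^ k else 0)
      ≤ (T / D) ^ k := by
  have hin : ∀ b, b = 1 ∨ b = -1 → 0 ≤ nInner (R b) Q ∧ nInner (R b) Q ≤ T / D := by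
    intro b hb
    have hcb : 0 < c b := hD.trans_le (hcD b hb)
    have heq : nInner (R b) Q
        = (∑ x ∈ univ.filter (fun x => x ∉ S ∧ m x = b), P x * Q x) / Fintype.card X / c b := by
      rw [nInner, expE, sum_filter, div_right_comm, sum_div _ _ (c b)]
      congr 1
      refine sum_congr rfl fun x _ => ?_
      rw [hR]
      split_ifs
      · ring
      · simp
    have h0 : 0 ≤ (∑ x ∈ univ.filter (fun x => x ∉ S ∧ m x = b), P x * Q x)
        / (Fintype.card X : ℝ) :=
      div_nonneg (sum_nonneg fun x _ => mul_nonneg (hP0 x) (hQ0 x)) (Nat.cast_nonneg _)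
    rw [heq]
    exact ⟨div_nonneg h0 hcb.le, div_le_div₀ (h0.trans (hT b hb)) (hT b hb) hD (hcD b hb)⟩
  have hsum : c (-1) + c 1 ≤ 1 := by
    rw [hc, hc, sum_filter_sign_eq hm S P (.inr rfl), sum_filter_sign_eq hm S P (.inl rfl), ← hP1]
    have : ∑ x, (if x ∉ S then P x else 0) ≤ ∑ x, P x :=
      sum_le_sum fun x _ => by split_ifs <;> [exact hP0 x; exact le_rfl]
    linarith
  have hterm : ∀ b, b = 1 ∨ b = -1 →
      (if 0 < c b then c b * nInner (R b) Q ^ k else 0) ≤ c b * (T / D) ^ k := by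
    intro b hb
    have hcb : 0 < c b := hD.trans_le (hcD b hb)
    rw [if_pos hcb]
    exact mul_le_mul_of_nonneg_left (pow_le_pow_left₀ (hin b hb).1 (hin b hb).2 k) hcb.le
  have hTD : 0 ≤ (T / D) ^ k :=
    pow_nonneg ((hin 1 (.inl rfl)).1.trans (hin 1 (.inl rfl)).2) k
  rw [sum_pair (by norm_num)]
  nlinarith [hterm 1 (.inl rfl), hterm (-1) (.inr rfl)]

/-- If `m` is nearly unbiased under `P` and `S` has little mass, then both signs of `m` have mass
close to `1 / 2` outside `S`. -/
theorem half_sub_le_sum_filter_sign {X : Type*} [Fintype X] {m P : X → ℝ} {S : Finset X} {ε : ℝ}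
    (hm : ∀ x, m x = 1 ∨ m x = -1) (hP0 : ∀ x, 0 ≤ P x) (hP1 : ∑ x, P x = 1)
    (hS : ∑ x ∈ S, P x ≤ ε) (hbias : |∑ x, m x * P x| ≤ ε) {b : ℝ} (hb : b = 1 ∨ b = -1) :
    (1 - 3 * ε) / 2 ≤ ∑ x ∈ univ.filter (fun x => x ∉ S ∧ m x = b), P x := by
  have hfull := sum_filter_sign_eq hm ∅ P hb
  simp only [notMem_empty, not_false_eq_true, true_and, if_true, hP1] at hfull
  have hle : ∑ x ∈ univ.filter (fun x => m x = b), P x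
      ≤ ∑ x ∈ univ.filter (fun x => x ∉ S ∧ m x = b), P x + ∑ x ∈ S, P x := by
    rw [sum_filter, sum_filter, ← sum_filter_add_sum_filter_not univ (· ∈ S)]
    rw [add_comm]
    have h1 : ∑ x ∈ univ.filter (· ∈ S), (if m x = b then P x else 0) ≤ ∑ x ∈ S, P x := by
      rw [filter_mem_eq_inter, univ_inter]
      exact sum_le_sum fun x _ => by split_ifs <;> [exact le_rfl; exact hP0 x]
    have h2 : ∑ x ∈ univ.filter (· ∉ S), (if m x = b then P x else 0)
        = ∑ x, if x ∉ S ∧ m x = b then P x else 0 := by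
      rw [sum_filter]
      exact sum_congr rfl fun x _ => (ite_and _ _ _ _).symm
    linarith
  have := abs_le.1 hbias
  rcases hb with rfl | rfl <;> linarith


/-- **Claim (one-step progress claim).**
There is an absolute constant `C > 0` such that: for `M` a `(k',ℓ')`-L₂
extractor with error `2^{-r'}`, `k ≥ 1` a natural number and `ℓ, r ≥ C` with
`2r ≤ r'`, `k + 2r ≤ k'`, `3ℓ + 2r + 2 ≤ ℓ'`, probability distributions `P, Q`
on `X` with `(E_x[P(x)²])^{1/2} ≤ 2^ℓ·2^{-n}` and
`(E_x[Q(x)²])^{1/2} ≤ 4·2^ℓ·2^{-n}` (`n = log₂|X|`), and with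
`Sig = {x : P(x) > 2^{2ℓ+2r}·2^{-n}}`, `Bad = {a : |∑_x M(a,x)P(x)| ≥ 2^{-r'}}`,
`c_{a,b} = ∑_{x ∉ Sig, M(a,x)=b} P(x)` and `P_{a,b}` the conditioned
distribution, one has
`(1/|A|)·∑_{a∉Bad} ∑_{b∈{-1,1}, c_{a,b}>0} c_{a,b}·⟨P_{a,b},Q⟩^k
  ≤ ⟨P,Q⟩^k·(1+2^{-r})^k + (2^{-2n+2})^k`. -/
theorem one_step_progress :
    ∃ C : ℝ, 0 < C ∧
      ∀ (A X : Type) [Fintype A] [Fintype X] (M : A → X → ℝ),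
        (∀ a x, M a x = 1 ∨ M a x = -1) →
        ∀ n : ℝ, n = Real.logb 2 (Fintype.card X) →
        ∀ k' ℓ' r' : ℝ, IsL2Extractor M k' ℓ' r' →
        ∀ k : ℕ, 1 ≤ k →
        ∀ ℓ r : ℝ, C ≤ ℓ → C ≤ r →
          2 * r ≤ r' → (k : ℝ) + 2 * r ≤ k' → 3 * ℓ + 2 * r + 2 ≤ ℓ' →
        ∀ P Q : X → ℝ,
          (∀ x, 0 ≤ P x) → (∑ x, P x) = 1 →
          (∀ x, 0 ≤ Q x) → (∑ x, Q x) = 1 →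
          nNorm2 P ≤ (2 : ℝ) ^ ℓ * (2 : ℝ) ^ (-n) →
          nNorm2 Q ≤ 4 * ((2 : ℝ) ^ ℓ * (2 : ℝ) ^ (-n)) →
        ∀ Sig : Finset X,
          Sig = Finset.univ.filter
            (fun x : X => (2 : ℝ) ^ (2 * ℓ + 2 * r) * (2 : ℝ) ^ (-n) < P x) →
        ∀ Bad : Finset A,
          Bad = Finset.univ.filter
            (fun a : A => (2 : ℝ) ^ (-r') ≤ |∑ x, M a x * P x|) →
        ∀ cab : A → ℝ → ℝ,
          (∀ a b, cab a b
            = ∑ x ∈ Finset.univ.filter (fun x : X => x ∉ Sig ∧ M a x = b), P x) →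
        ∀ Pab : A → ℝ → X → ℝ,
          (∀ a b x, Pab a b x
            = if x ∉ Sig ∧ M a x = b then P x / cab a b else 0) →
          (1 / (Fintype.card A : ℝ))
              * ∑ a ∈ Finset.univ.filter (fun a : A => a ∉ Bad),
                  ∑ b ∈ ({-1, 1} : Finset ℝ),
                    (if 0 < cab a b then cab a b * (nInner (Pab a b) Q) ^ k else 0)
            ≤ (nInner P Q) ^ k * (1 + (2 : ℝ) ^ (-r)) ^ k
                + ((2 : ℝ) ^ (-(2 * n) + 2)) ^ k := by
  refine ⟨3, by norm_num, ?_⟩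
  intro A X _ _ M hM n hn k' ℓ' r' hext k hk ℓ r _ hr hr' hk' hℓ' P Q hP0 hP1 hQ0 _ hPn hQn
    Sig hSig Bad hBad c hc R hR
  have hX : 0 < (Fintype.card X : ℝ) := by
    have : Nonempty X := by
      by_contra h
      rw [not_nonempty_iff] at h
      simp at hP1
    exact_mod_cast Fintype.card_pos
  set u : ℝ := 2 ^ (-n) with hu_def
  have hu : 0 < u := by positivity
  have hNu : (Fintype.card X : ℝ) * u = 1 := by
    rw [hu_def, Real.rpow_neg two_pos.le, hn,
      Real.rpow_logb two_pos (by norm_num) hX, mul_inv_cancel₀ hX.ne']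
  have htwo_n : (2 : ℝ) ^ (-(2 * n) + 2) = 4 * u ^ 2 := by
    rw [Real.rpow_add two_pos, show -(2 * n) = -n + -n by ring, Real.rpow_add two_pos]
    norm_num
    ring
  set δ : ℝ := 2 ^ (-r)
  have hδ : 0 < δ := by positivity
  have hδ8 : δ ≤ 1 / 8 := by
    calc δ ≤ (2 : ℝ) ^ (-3 : ℝ) := Real.rpow_le_rpow_of_exponent_le one_le_two (by linarith)
      _ = 1 / 8 := by norm_num [Real.rpow_neg]
  have hδsq : (2 : ℝ) ^ (-(2 * r)) = δ ^ 2 := by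
    rw [show -(2 * r) = -r + -r by ring, Real.rpow_add two_pos, sq]
  have herr : (2 : ℝ) ^ (-r') ≤ δ ^ 2 :=
    hδsq ▸ Real.rpow_le_rpow_of_exponent_le one_le_two (by linarith)
  have hSigMass : ∑ x ∈ Sig, P x ≤ δ ^ 2 := by
    rw [hSig, ← hδsq]
    refine (sum_heavy_le (by positivity) hu (by positivity) hNu hPn).trans_eq ?_
    rw [← Real.rpow_natCast, ← Real.rpow_mul two_pos.le, ← Real.rpow_sub two_pos]
    congr 1
    push_cast
    ring
  have hD : 1 / 4 ≤ (1 - 3 * δ ^ 2) / 2 := by nlinarith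
  have hD0 : 0 < (1 - 3 * δ ^ 2) / 2 := by linarith
  have hcD : ∀ a ∈ univ.filter (fun a : A => a ∉ Bad), ∀ b, b = 1 ∨ b = -1 →
      (1 - 3 * δ ^ 2) / 2 ≤ c a b := by
    intro a ha b hb
    rw [hc]
    refine half_sub_le_sum_filter_sign (hM a) hP0 hP1 hSigMass ?_ hb
    simp only [hBad, mem_filter, mem_univ, true_and, not_le] at ha
    exact ha.le.trans herr
  set f : X → ℝ := fun x => if x ∉ Sig then P x * Q x else 0 with hf_def
  have hf0 : ∀ x, 0 ≤ f x := fun x => by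
    simp only [hf_def]
    split_ifs
    exacts [le_rfl, mul_nonneg (hP0 x) (hQ0 x)]
  have hnorm1 : nNorm1 f = expE f := by
    simp only [nNorm1, abs_of_nonneg (hf0 _)]
  have hF0 : 0 ≤ expE f := div_nonneg (sum_nonneg fun x _ => hf0 x) hX.le
  have hFPQ : expE f ≤ nInner P Q := by
    rw [nInner, expE, expE]
    gcongr with x
    simp only [hf_def]
    split_ifs
    exacts [mul_nonneg (hP0 x) (hQ0 x), le_rfl]
  have hside : ∀ a b, b = 1 ∨ b = -1 →
      (∑ x ∈ univ.filter (fun x => x ∉ Sig ∧ M a x = b), P x * Q x) / (Fintype.card X : ℝ)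
        = (expE f + b * nInner (M a) f) / 2 := by
    intro a b hb
    rw [sum_filter_sign_eq (hM a) Sig _ hb, nInner, expE, expE]
    ring
  have hside_le : ∀ a b, b = 1 ∨ b = -1 →
      (∑ x ∈ univ.filter (fun x => x ∉ Sig ∧ M a x = b), P x * Q x) / (Fintype.card X : ℝ)
        ≤ expE f := by
    intro a b _
    rw [expE, sum_filter]
    gcongr with x
    by_cases hx : x ∈ Sig
    · simp [hf_def, hx]
    · have := mul_nonneg (hP0 x) (hQ0 x)
      by_cases hMx : M a x = b <;> simp [hf_def, hx, hMx, this]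
  have hbound : ∀ a ∈ univ.filter (fun a : A => a ∉ Bad),
      ∑ b ∈ ({-1, 1} : Finset ℝ), (if 0 < c a b then c a b * nInner (R a b) Q ^ k else 0)
        ≤ (expE f / ((1 - 3 * δ ^ 2) / 2)) ^ k := fun a ha =>
    sum_sign_mul_pow_le (hM a) hP0 hP1 hQ0 (hc a) (hR a) hD0 (hcD a ha) (hside_le a)
  have hPQ0 : 0 ≤ nInner P Q := hF0.trans hFPQ
  rw [htwo_n]
  rcases le_or_gt (expE f) (u ^ 2) with hsmall | hlarge
  · have hle : expE f / ((1 - 3 * δ ^ 2) / 2) ≤ 4 * u ^ 2 := by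
      rw [div_le_iff₀ hD0]
      nlinarith [sq_nonneg u]
    have hb : ∀ a ∈ univ.filter (fun a : A => a ∉ Bad),
        ∑ b ∈ ({-1, 1} : Finset ℝ), (if 0 < c a b then c a b * nInner (R a b) Q ^ k else 0)
          ≤ (4 * u ^ 2) ^ k := fun a ha =>
      (hbound a ha).trans (pow_le_pow_left₀ (div_nonneg hF0 hD0.le) hle k)
    have hu_pow : 0 ≤ (4 * u ^ 2) ^ k := by positivity
    refine (avg_le_of_card_le (E := ∅) hu_pow hu_pow le_rfl (by simp)
      (fun a ha _ => hb a ha) hb).trans ?_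
    rw [zero_mul, add_zero]
    exact le_add_of_nonneg_left (by positivity)
  · have hnorm2 : nNorm2 f ≤ (2 : ℝ) ^ ℓ' * nNorm1 f := by
      have hfQ : ∀ x, f x ≤ (2 : ℝ) ^ (2 * ℓ + 2 * r) * u * Q x := by
        intro x
        have hQx := hQ0 x
        simp only [hf_def]
        split_ifs with hx
        · positivity
        · simp only [hSig, mem_filter, mem_univ, true_and, not_lt] at hx
          gcongr
      calc nNorm2 f ≤ (2 : ℝ) ^ (2 * ℓ + 2 * r) * u * nNorm2 Q :=
            nNorm2_le_mul (by positivity) hf0 hfQ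
        _ ≤ (2 : ℝ) ^ (2 * ℓ + 2 * r) * u * (4 * ((2 : ℝ) ^ ℓ * u)) := by gcongr
        _ = (2 : ℝ) ^ (3 * ℓ + 2 * r + 2) * u ^ 2 := by
            rw [show 3 * ℓ + 2 * r + 2 = (2 * ℓ + 2 * r) + ℓ + 2 by ring,
              Real.rpow_add two_pos _ 2, Real.rpow_add two_pos _ ℓ]
            norm_num
            ring
        _ ≤ (2 : ℝ) ^ ℓ' * nNorm1 f := by
            rw [hnorm1]
            gcongr
            exact one_le_two
    have hfne : f ≠ 0 := by
      rintro h
      rw [h] at hlarge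
      simp only [expE, Pi.zero_apply, sum_const_zero, zero_div] at hlarge
      nlinarith [sq_nonneg u]
    have hcard := hext f hf0 hfne hnorm2
    have hgood : ∀ a ∈ univ.filter (fun a : A => a ∉ Bad),
        a ∉ univ.filter (fun a : A => (2 : ℝ) ^ (-r') * nNorm1 f ≤ |nInner (M a) f|) →
        ∑ b ∈ ({-1, 1} : Finset ℝ), (if 0 < c a b then c a b * nInner (R a b) Q ^ k else 0)
          ≤ (expE f * (1 + δ ^ 2) / 2 / ((1 - 3 * δ ^ 2) / 2)) ^ k := by
      intro a ha haE
      refine sum_sign_mul_pow_le (hM a) hP0 hP1 hQ0 (hc a) (hR a) hD0 (hcD a ha) fun b hb => ?_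
      rw [hside a b hb]
      simp only [mem_filter, mem_univ, true_and, not_le, hnorm1] at haE
      have := abs_le.1 (haE.le.trans (mul_le_mul_of_nonneg_right herr hF0))
      rcases hb with rfl | rfl <;> linarith
    have hη : (2 : ℝ) ^ (-k') * 2 ^ k ≤ δ ^ 2 := by
      rw [← hδsq, ← Real.rpow_natCast 2 k, ← Real.rpow_add two_pos]
      exact Real.rpow_le_rpow_of_exponent_le one_le_two (by linarith)
    have hD1 : 0 < 1 - 3 * δ ^ 2 := by linarith
    have hratio0 : 0 ≤ (1 + 2 * δ ^ 2) / (1 - 3 * δ ^ 2) := div_nonneg (by positivity) hD1.le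
    have hratio : (1 + 2 * δ ^ 2) / (1 - 3 * δ ^ 2) ≤ 1 + δ := by
      rw [div_le_iff₀ hD1]
      nlinarith [mul_pos hδ hδ, mul_pos hδ (mul_pos hδ hδ)]
    have havg := avg_le_of_card_le (by positivity) (by positivity) (by positivity)
      hcard hgood hbound
    refine havg.trans (le_add_of_le_of_nonneg ?_ (by positivity))
    calc (expE f * (1 + δ ^ 2) / 2 / ((1 - 3 * δ ^ 2) / 2)) ^ k
          + (2 : ℝ) ^ (-k') * (expE f / ((1 - 3 * δ ^ 2) / 2)) ^ k
        = (expE f / (1 - 3 * δ ^ 2)) ^ k * ((1 + δ ^ 2) ^ k + (2 : ℝ) ^ (-k') * 2 ^ k) := by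
          simp only [div_pow, mul_pow]
          field_simp
      _ ≤ (expE f / (1 - 3 * δ ^ 2)) ^ k * (1 + 2 * δ ^ 2) ^ k := by
          gcongr
          exact (add_le_add_right hη _).trans (pow_add_le_add_pow (by positivity) hk)
      _ = (expE f * ((1 + 2 * δ ^ 2) / (1 - 3 * δ ^ 2))) ^ k := by
          rw [← mul_pow]
          ring
      _ ≤ (nInner P Q * (1 + δ)) ^ k := by
          exact pow_le_pow_left₀ (mul_nonneg hF0 hratio0)
            (mul_le_mul hFPQ hratio hratio0 hPQ0) k
      _ = nInner P Q ^ k * (1 + δ) ^ k := mul_pow _ _ _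
end

section
/- Let n ≥ 1 and let T ⊆ {0,1}ⁿ be a nonempty (ε,δ)-biased set, where ε, δ > 0 and ε + δ^{1/2} < 1. Define M : {0,1}ⁿ × T → {-1,1} by M(a,x) = (-1)^{a·x}, where a·x is the inner product of a and x modulo 2. Then M is a (k,ℓ)-L₂-extractor with error 2^{-r}, where k = (1/2)·log₂(1/δ) and ℓ = r = (1/4)·log₂(1/(ε + δ^{1/2})). -/
open Finset

attribute [local instance] Classical.propDecidable

/-- The parity character `x ↦ (-1)^{a·x}` of `{0,1}ⁿ`. -/
noncomputable def parityChar {n : ℕ} (a x : Fin n → ZMod 2) : ℝ :=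
  if (∑ i, a i * x i : ZMod 2) = 0 then (1 : ℝ) else -1

theorem parityChar_mul {n : ℕ} (a b x : Fin n → ZMod 2) :
    parityChar a x * parityChar b x = parityChar (a + b) x := by
  have h : (∑ i, (a + b) i * x i : ZMod 2) = ∑ i, a i * x i + ∑ i, b i * x i := by
    simp [add_mul, Finset.sum_add_distrib]
  unfold parityChar
  rw [h]
  generalize (∑ i, a i * x i : ZMod 2) = u
  generalize (∑ i, b i * x i : ZMod 2) = v
  have hu : u = 0 ∨ u = 1 := by revert u; decide
  have hv : v = 0 ∨ v = 1 := by revert v; decide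
  have h2 : (1 + 1 : ZMod 2) = 0 := by decide
  rcases hu with rfl | rfl <;> rcases hv with rfl | rfl <;> simp [h2]

theorem abs_parityChar {n : ℕ} (a x : Fin n → ZMod 2) : |parityChar a x| = 1 := by
  unfold parityChar
  split_ifs <;> simp

/-- The uniform average over `T` of a parity character is at most one in absolute value. -/
theorem abs_sum_parityChar_div_le_one {n : ℕ} (T : Finset (Fin n → ZMod 2))
    (a : Fin n → ZMod 2) : |(∑ x ∈ T, parityChar a x) / (T.card : ℝ)| ≤ 1 := by
  rw [abs_div, Nat.abs_cast]
  refine div_le_one_of_le₀ ?_ (Nat.cast_nonneg _)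
  refine (Finset.abs_sum_le_sum_abs _ _).trans ?_
  simp [abs_parityChar]

/-- If every row indexed by `S` correlates with `f`, then the total pairwise correlation of these
rows is large. -/
theorem sq_card_mul_le_sum_abs_nInner {A X : Type*} [Fintype X] (M : A → X → ℝ) (S : Finset A)
    (f : X → ℝ) {c : ℝ} (hc : 0 ≤ c) (hS : ∀ a ∈ S, c ≤ |nInner (M a) f|) :
    ((S.card : ℝ) * c) ^ 2 ≤
      (∑ a ∈ S, ∑ b ∈ S, |nInner (M a) (M b)|) * expE (fun x => f x ^ 2) := by
  set s : A → ℝ := fun a => SignType.sign (nInner (M a) f) with hs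
  have hs1 : ∀ a, |s a| ≤ 1 := by
    intro a
    rcases lt_trichotomy (nInner (M a) f) 0 with h | h | h <;> simp [hs, h]
  set N : ℝ := (Fintype.card X : ℝ)
  have hN0 : 0 ≤ N := Nat.cast_nonneg _
  set g : X → ℝ := fun x => ∑ a ∈ S, s a * M a x with hg
  have hlower : (S.card : ℝ) * c ≤ (∑ x, g x * f x) / N := by
    have h1 : (∑ x, g x * f x) / N = ∑ a ∈ S, |nInner (M a) f| := by
      have h2 : ∀ a, |nInner (M a) f| = s a * ((∑ x, M a x * f x) / N) := by
        intro a
        exact (sign_mul_self (nInner (M a) f)).symm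
      simp only [h2, hg, Finset.sum_mul]
      rw [Finset.sum_comm, Finset.sum_div]
      refine Finset.sum_congr rfl fun a _ => ?_
      rw [mul_div_assoc', Finset.mul_sum]
      simp only [mul_assoc]
    rw [h1, ← nsmul_eq_mul]
    exact Finset.card_nsmul_le_sum _ _ _ hS
  have hcs : ((∑ x, g x * f x) / N) ^ 2 ≤
      ((∑ x, g x ^ 2) / N) * ((∑ x, f x ^ 2) / N) := by
    rw [div_pow, div_mul_div_comm, ← sq]
    exact div_le_div_of_nonneg_right (Finset.sum_mul_sq_le_sq_mul_sq _ _ _) (sq_nonneg _)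
  have hgg : (∑ x, g x ^ 2) / N ≤ ∑ a ∈ S, ∑ b ∈ S, |nInner (M a) (M b)| := by
    have h1 : (∑ x, g x ^ 2) / N =
        ∑ a ∈ S, ∑ b ∈ S, s a * s b * nInner (M a) (M b) := by
      have h2 : ∀ x, g x ^ 2 = ∑ a ∈ S, ∑ b ∈ S, s a * s b * (M a x * M b x) := by
        intro x
        rw [sq, hg, Finset.sum_mul_sum]
        refine Finset.sum_congr rfl fun a _ => Finset.sum_congr rfl fun b _ => ?_
        ring
      simp only [h2]
      rw [Finset.sum_comm, Finset.sum_div]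
      refine Finset.sum_congr rfl fun a _ => ?_
      rw [Finset.sum_comm, Finset.sum_div]
      refine Finset.sum_congr rfl fun b _ => ?_
      rw [← Finset.mul_sum, mul_div_assoc]
      rfl
    rw [h1]
    refine Finset.sum_le_sum fun a _ => Finset.sum_le_sum fun b _ => ?_
    refine (le_abs_self _).trans ?_
    rw [abs_mul, abs_mul]
    exact mul_le_of_le_one_left (abs_nonneg _)
      (mul_le_one₀ (hs1 a) (abs_nonneg _) (hs1 b))
  calc ((S.card : ℝ) * c) ^ 2 ≤ ((∑ x, g x * f x) / N) ^ 2 :=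
        pow_le_pow_left₀ (by positivity) hlower 2
    _ ≤ _ := hcs
    _ ≤ _ := mul_le_mul_of_nonneg_right hgg
        (div_nonneg (Finset.sum_nonneg fun _ _ => sq_nonneg _) hN0)

/-- A bounded function on a finite group which exceeds `ε` at most `K` times has small sum over
every translate of a finite set. -/
theorem sum_add_left_le_of_card_filter_le {G : Type*} [AddGroup G] [Fintype G] {F : G → ℝ}
    {ε K : ℝ} (hε : 0 ≤ ε) (hF : ∀ a, F a ≤ 1)
    (hK : ((Finset.univ.filter (fun a : G => ε < F a)).card : ℝ) ≤ K) (S : Finset G) (a : G) :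
    ∑ b ∈ S, F (a + b) ≤ ε * S.card + K := by
  have hpt : ∀ b, F (a + b) ≤ ε + if ε < F (a + b) then (1 : ℝ) else 0 := by
    intro b
    split_ifs with h
    · linarith [hF (a + b)]
    · linarith
  have hcard : ∑ b ∈ S, (if ε < F (a + b) then (1 : ℝ) else 0) ≤ K := by
    calc ∑ b ∈ S, (if ε < F (a + b) then (1 : ℝ) else 0)
        ≤ ∑ b, (if ε < F (a + b) then (1 : ℝ) else 0) :=
          Finset.sum_le_sum_of_subset_of_nonneg (Finset.subset_univ _)
            fun b _ _ => by split_ifs <;> norm_num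
      _ = ∑ b, (if ε < F b then (1 : ℝ) else 0) :=
          Equiv.sum_comp (Equiv.addLeft a) fun b => if ε < F b then (1 : ℝ) else 0
      _ ≤ K := by rwa [Finset.sum_boole]
  calc ∑ b ∈ S, F (a + b)
      ≤ ∑ b ∈ S, (ε + if ε < F (a + b) then (1 : ℝ) else 0) :=
        Finset.sum_le_sum fun b _ => hpt b
    _ ≤ ε * S.card + K := by
        rw [Finset.sum_add_distrib, Finset.sum_const, nsmul_eq_mul]
        linarith

theorem two_rpow_mul_logb_one_div {y : ℝ} (hy : 0 < y) (t : ℝ) :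
    (2 : ℝ) ^ (t * Real.logb 2 (1 / y)) = y ^ (-t) := by
  rw [mul_comm, Real.rpow_mul (by norm_num), Real.rpow_logb (by norm_num) (by norm_num)
    (by positivity), one_div, Real.inv_rpow hy.le, Real.rpow_neg hy.le]

/-- **Lemma (parity learning over a biased set).**
If `T ⊆ {0,1}ⁿ` is a nonempty `(ε,δ)`-biased set with `ε, δ > 0` and
`ε + δ^{1/2} < 1`, then the matrix `M : {0,1}ⁿ × T → {-1,1}` defined by
`M(a,x) = (-1)^{a·x}` is a `(k,ℓ)`-L₂-extractor with error `2^{-r}`, where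
`k = ½·log₂(1/δ)` and `ℓ = r = ¼·log₂(1/(ε + δ^{1/2}))`. -/
theorem biased_set_l2Extractor (n : ℕ) (hn : 1 ≤ n)
    (T : Finset (Fin n → ZMod 2)) (hT : T.Nonempty)
    (ε δ : ℝ) (hε : 0 < ε) (hδ : 0 < δ) (hsum : ε + Real.sqrt δ < 1)
    (hbias : ((Finset.univ.filter (fun a : Fin n → ZMod 2 =>
        ε < |(∑ x ∈ T, (if (∑ i, a i * x i : ZMod 2) = 0 then (1 : ℝ) else -1))
              / (T.card : ℝ)|)).card : ℝ)
      ≤ δ * 2 ^ n) :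
    IsL2Extractor
      (fun (a : Fin n → ZMod 2) (x : {y // y ∈ T}) =>
        if (∑ i, a i * (x : Fin n → ZMod 2) i : ZMod 2) = 0 then (1 : ℝ) else -1)
      (1 / 2 * Real.logb 2 (1 / δ))
      (1 / 4 * Real.logb 2 (1 / (ε + Real.sqrt δ)))
      (1 / 4 * Real.logb 2 (1 / (ε + Real.sqrt δ))) := by
  intro f _ hf0 hf2
  have hη : 0 < ε + Real.sqrt δ := add_pos_of_pos_of_nonneg hε (Real.sqrt_nonneg _)
  have hk : (2 : ℝ) ^ (-(1 / 2 * Real.logb 2 (1 / δ))) = Real.sqrt δ := by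
    rw [← neg_mul, two_rpow_mul_logb_one_div hδ, neg_neg, Real.sqrt_eq_rpow]
  have hA : (Fintype.card (Fin n → ZMod 2) : ℝ) = 2 ^ n := by simp
  rw [two_rpow_mul_logb_one_div hη] at hf2
  rw [hk, hA, ← neg_mul, two_rpow_mul_logb_one_div hη, neg_neg]
  set η := ε + Real.sqrt δ with hη_def
  have hf1 := nNorm1_pos hf0
  set M : (Fin n → ZMod 2) → {y // y ∈ T} → ℝ := fun a x => parityChar a x with hM
  change ((Finset.univ.filter
    (fun a => η ^ (1 / 4 : ℝ) * nNorm1 f ≤ |nInner (M a) f|)).card : ℝ) ≤ _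
  set S := Finset.univ.filter
    (fun a => η ^ (1 / 4 : ℝ) * nNorm1 f ≤ |nInner (M a) f|) with hS
  by_contra! hlt
  have hScard : (0 : ℝ) < S.card := lt_of_le_of_lt (by positivity) hlt
  have hlower := sq_card_mul_le_sum_abs_nInner M S f
    (c := η ^ (1 / 4 : ℝ) * nNorm1 f) (by positivity) fun a ha => (Finset.mem_filter.mp ha).2
  have hinner : ∀ a b, |nInner (M a) (M b)| =
      |(∑ x ∈ T, parityChar (a + b) x) / (T.card : ℝ)| := by
    intro a b
    simp only [nInner, expE, hM, parityChar_mul, Fintype.card_coe]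
    rw [Finset.sum_coe_sort T (fun x => parityChar (a + b) x)]
  have hδη : δ * 2 ^ n < Real.sqrt δ * S.card := by
    calc δ * 2 ^ n = Real.sqrt δ * (Real.sqrt δ * 2 ^ n) := by
          rw [← mul_assoc, Real.mul_self_sqrt hδ.le]
      _ < Real.sqrt δ * S.card := mul_lt_mul_of_pos_left hlt (Real.sqrt_pos.mpr hδ)
  have hupper : ∑ a ∈ S, ∑ b ∈ S, |nInner (M a) (M b)| < (S.card : ℝ) ^ 2 * η := by
    calc ∑ a ∈ S, ∑ b ∈ S, |nInner (M a) (M b)|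
        ≤ ∑ a ∈ S, (ε * S.card + δ * 2 ^ n) := by
          refine Finset.sum_le_sum fun a _ => ?_
          simp only [hinner]
          exact sum_add_left_le_of_card_filter_le
            (F := fun a => |(∑ x ∈ T, parityChar a x) / (T.card : ℝ)|) hε.le
            (abs_sum_parityChar_div_le_one T) hbias S a
      _ = S.card * (ε * S.card + δ * 2 ^ n) := by rw [Finset.sum_const, nsmul_eq_mul]
      _ < S.card * (ε * S.card + Real.sqrt δ * S.card) :=
          mul_lt_mul_of_pos_left (by linarith) hScard
      _ = (S.card : ℝ) ^ 2 * η := by rw [hη_def]; ring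
  have hf2sq : expE (fun x => f x ^ 2) ≤ (η ^ (-(1 / 4) : ℝ) * nNorm1 f) ^ 2 :=
    Real.sqrt_le_iff.mp hf2 |>.2
  have hpow : η * (η ^ (-(1 / 4) : ℝ)) ^ 2 = (η ^ (1 / 4 : ℝ)) ^ 2 := by
    rw [← Real.rpow_mul_natCast hη.le, ← Real.rpow_mul_natCast hη.le]
    nth_rewrite 1 [← Real.rpow_one η]
    rw [← Real.rpow_add hη]
    norm_num
  refine lt_irrefl (((S.card : ℝ) * (η ^ (1 / 4 : ℝ) * nNorm1 f)) ^ 2) ?_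
  calc ((S.card : ℝ) * (η ^ (1 / 4 : ℝ) * nNorm1 f)) ^ 2
      ≤ _ := hlower
    _ ≤ (∑ a ∈ S, ∑ b ∈ S, |nInner (M a) (M b)|) * (η ^ (-(1 / 4) : ℝ) * nNorm1 f) ^ 2 :=
        mul_le_mul_of_nonneg_left hf2sq
          (Finset.sum_nonneg fun _ _ => Finset.sum_nonneg fun _ _ => abs_nonneg _)
    _ < (S.card : ℝ) ^ 2 * η * (η ^ (-(1 / 4) : ℝ) * nNorm1 f) ^ 2 :=
        mul_lt_mul_of_pos_right hupper (by positivity)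
    _ = (S.card : ℝ) ^ 2 * (η * (η ^ (-(1 / 4) : ℝ)) ^ 2) * nNorm1 f ^ 2 := by ring
    _ = ((S.card : ℝ) * (η ^ (1 / 4 : ℝ) * nNorm1 f)) ^ 2 := by rw [hpow]; ring
end
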